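/- For every well-initialized time-divergent infinite play π̄ of the expanded timed game G(p,λ): π̄ satisfies the co-Büchi objective coBüchi(Bad) if and only if its projection Pr(π̄) satisfies the timed window objective TW(p,λ) in G, where Bad = L × {bad}. -/

import Mathlib

open scoped NNReal

namespace TWPaper

variable {L C Act : Type}

/-- Comparison operators appearing in clock constraints. -/
inductive Cmp where
  | le | ge | lt | gt

/-- An atomic clock constraint `x ∼ c` with `c : ℕ`. -/
structure Atom (C : Type) where
  clock : C
  cmp : Cmp
  bound : ℕ

/-- Clock valuations. -/
abbrev Val (C : Type) := C → ℝ≥0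

def Atom.sat (ν : Val C) (a : Atom C) : Prop :=
  match a.cmp with
  | Cmp.le => ν a.clock ≤ (a.bound : ℝ≥0)
  | Cmp.ge => (a.bound : ℝ≥0) ≤ ν a.clock
  | Cmp.lt => ν a.clock < (a.bound : ℝ≥0)
  | Cmp.gt => (a.bound : ℝ≥0) < ν a.clock

/-- A clock constraint: a finite conjunction of atomic constraints. -/
abbrev ClockConstraint (C : Type) := List (Atom C)

def satCC (ν : Val C) (g : ClockConstraint C) : Prop := ∀ a ∈ g, a.sat ν

/-- Let `d` time units pass. -/
def shift (ν : Val C) (d : ℝ≥0) : Val C := fun x => ν x + d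

open Classical in
/-- Reset the clocks in `D` to `0`. -/
noncomputable def resetV (D : Set C) (ν : Val C) : Val C :=
  fun x => if x ∈ D then 0 else ν x

structure Edge (L C Act : Type) where
  src : L
  guard : ClockConstraint C
  act : Act
  resets : Set C
  tgt : L

/-- A timed automaton. -/
structure TA (L C Act : Type) where
  init : L
  gamma : C
  inv : L → ClockConstraint C
  edges : Set (Edge L C Act)

/-- Well-formedness of a timed automaton: the special global clock `γ` is never
reset, and no two edges from the same location sharing an action have
simultaneously satisfiable guards (determinism). -/
def TA.WellFormed (A : TA L C Act) : Prop :=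
  (∀ e ∈ A.edges, A.gamma ∉ e.resets) ∧
  (∀ e₁ ∈ A.edges, ∀ e₂ ∈ A.edges, e₁.src = e₂.src → e₁.act = e₂.act →
    (∃ ν : Val C, satCC ν e₁.guard ∧ satCC ν e₂.guard) → e₁ = e₂)

/-- A move: a delay together with an action (`none` is the special delay action `⊥`). -/
abbrev Mv (Act : Type) := ℝ≥0 × Option Act

/-- The transition relation of the transition system of a timed automaton. -/
def TA.Trans (A : TA L C Act) (s : L × Val C) (m : Mv Act) (s' : L × Val C) : Prop :=
  satCC (shift s.2 m.1) (A.inv s.1) ∧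
  (match m.2 with
   | none => s'.1 = s.1 ∧ s'.2 = shift s.2 m.1
   | some a => ∃ e ∈ A.edges, e.src = s.1 ∧ e.act = a ∧
       satCC (shift s.2 m.1) e.guard ∧ s'.1 = e.tgt ∧
       s'.2 = resetV e.resets (shift s.2 m.1) ∧ satCC s'.2 (A.inv e.tgt))

/-- An infinite path of a timed automaton (the underlying data). -/
structure RawPath (L C Act : Type) where
  s : ℕ → L × Val C
  m : ℕ → Mv Act

def TA.IsPath (A : TA L C Act) (π : RawPath L C Act) : Prop :=
  ∀ n, A.Trans (π.s n) (π.m n) (π.s (n + 1))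

/-- A timed game: a timed automaton together with a partition of the actions;
`isP1 a` means that `a` is a player-1 action (its complement is player 2's set). -/
structure TG (L C Act : Type) where
  ta : TA L C Act
  isP1 : Act → Prop

/-- Moves available to player 1 in state `s`. -/
def TG.Move1 (G : TG L C Act) (s : L × Val C) (m : Mv Act) : Prop :=
  (∀ a, m.2 = some a → G.isP1 a) ∧ ∃ s', G.ta.Trans s m s'

/-- Moves available to player 2 in state `s`. -/
def TG.Move2 (G : TG L C Act) (s : L × Val C) (m : Mv Act) : Prop :=
  (∀ a, m.2 = some a → ¬ G.isP1 a) ∧ ∃ s', G.ta.Trans s m s'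

/-- An infinite play of a timed game (the underlying data). -/
structure RawPlay (L C Act : Type) where
  s : ℕ → L × Val C
  m1 : ℕ → Mv Act
  m2 : ℕ → Mv Act

/-- The delay at step `n`: the minimum of the delays of the two chosen moves. -/
def RawPlay.delay (π : RawPlay L C Act) (n : ℕ) : ℝ≥0 := min (π.m1 n).1 (π.m2 n).1

/-- The play obtained by removing the first `n` steps. -/
def RawPlay.drop (π : RawPlay L C Act) (n : ℕ) : RawPlay L C Act :=
  ⟨fun k => π.s (n + k), fun k => π.m1 (n + k), fun k => π.m2 (n + k)⟩

/-- The joint destination relation: the fastest move is carried out,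
nondeterministically so in case of a tie. -/
def TG.JointDest (G : TG L C Act) (s : L × Val C) (m₁ m₂ : Mv Act) (s' : L × Val C) : Prop :=
  (m₁.1 < m₂.1 ∧ G.ta.Trans s m₁ s') ∨ (m₂.1 < m₁.1 ∧ G.ta.Trans s m₂ s') ∨
  (m₁.1 = m₂.1 ∧ (G.ta.Trans s m₁ s' ∨ G.ta.Trans s m₂ s'))

def TG.StepOK (G : TG L C Act) (π : RawPlay L C Act) (n : ℕ) : Prop :=
  G.Move1 (π.s n) (π.m1 n) ∧ G.Move2 (π.s n) (π.m2 n) ∧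
  G.JointDest (π.s n) (π.m1 n) (π.m2 n) (π.s (n + 1))

def TG.IsPlay (G : TG L C Act) (π : RawPlay L C Act) : Prop := ∀ n, G.StepOK π n

/-- `π` is a valid play for its first `n` steps (i.e., viewed as a finite play
consisting of `n` moves). -/
def TG.IsPlayUpTo (G : TG L C Act) (π : RawPlay L C Act) (n : ℕ) : Prop :=
  ∀ k < n, G.StepOK π k

/-- The state/delay sequence of a play or path.  All the objectives considered
are state-based and are therefore defined on traces. -/
structure Trace (L C : Type) where
  st : ℕ → L × Val C
  dl : ℕ → ℝ≥0

def RawPlay.trace (π : RawPlay L C Act) : Trace L C := ⟨π.s, fun n => π.delay n⟩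
def RawPath.trace (π : RawPath L C Act) : Trace L C := ⟨π.s, fun n => (π.m n).1⟩

/-- The delayed suffix `π_{n→}^{+d}`. -/
noncomputable def Trace.delayedSuffix (τ : Trace L C) (n : ℕ) (d : ℝ≥0) : Trace L C where
  st := fun k => if k = 0 then ((τ.st n).1, shift (τ.st n).2 d) else τ.st (n + k)
  dl := fun k => if k = 0 then τ.dl n - d else τ.dl (n + k)

/-- The suffix `π_{n→} = π_{n→}^{+0}`. -/
noncomputable def Trace.suffix (τ : Trace L C) (n : ℕ) : Trace L C := τ.delayedSuffix n 0

/-- `min_{a ≤ k ≤ b} p(ℓ_k)`. -/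
noncomputable def minPrioIcc (p : L → ℕ) (τ : Trace L C) (a b : ℕ) : ℕ :=
  sInf ((fun k => p (τ.st k).1) '' Set.Icc a b)

/-- The timed good window objective `TGW(p, λ)`. -/
def TGW (γ : C) (p : L → ℕ) (lam : ℕ) : Set (Trace L C) :=
  {τ | ∃ j : ℕ, Even (minPrioIcc p τ 0 j) ∧ (τ.st j).2 γ - (τ.st 0).2 γ < (lam : ℝ≥0)}

/-- The direct timed window parity objective `DTW(p, λ)`. -/
def DTW (γ : C) (p : L → ℕ) (lam : ℕ) : Set (Trace L C) :=
  {τ | ∀ n : ℕ, ∀ d : ℝ≥0, d ≤ τ.dl n → τ.delayedSuffix n d ∈ TGW γ p lam}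

/-- The timed window parity objective `TW(p, λ)`. -/
def TW (γ : C) (p : L → ℕ) (lam : ℕ) : Set (Trace L C) :=
  {τ | ∃ n : ℕ, τ.suffix n ∈ DTW γ p lam}

/-- Time divergence: the global clock `γ` is unbounded along the trace. -/
def TimeDiv (γ : C) (τ : Trace L C) : Prop := ∀ B : ℝ≥0, ∃ j, B < (τ.st j).2 γ

/-- The parity objective: the least priority seen infinitely often is even. -/
def ParityObj (p : L → ℕ) : Set (Trace L C) :=
  {τ | Even (Filter.liminf (fun n => p (τ.st n).1) Filter.atTop)}

/-- The safety objective for the set `F` of locations. -/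
def SafeObj (F : Set L) : Set (Trace L C) := {τ | ∀ n, (τ.st n).1 ∉ F}

/-- The co-Büchi objective for the set `F` of locations. -/
def CoBuchiObj (F : Set L) : Set (Trace L C) := {τ | ∃ N, ∀ n ≥ N, (τ.st n).1 ∉ F}

/-! ### The expanded timed automaton (one dimension) -/

/-- Locations of the expanded automaton: `(ℓ, some q)` carries the priority `q`
of the current window, `(ℓ, none)` is the bad location `(ℓ, bad)`. -/
abbrev ExpLoc (L : Type) := L × Option ℕ
/-- Clocks of the expanded automaton: `none` is the fresh clock `z`. -/
abbrev ExpClock (C : Type) := Option C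
/-- Actions of the expanded automaton: `Sum.inr true = β₁` and `Sum.inr false = β₂`. -/
abbrev ExpAct (Act : Type) := Act ⊕ Bool

def liftAtom {C C' : Type} (f : C → C') (a : Atom C) : Atom C' := ⟨f a.clock, a.cmp, a.bound⟩

def liftCC {C C' : Type} (f : C → C') (g : ClockConstraint C) : ClockConstraint C' :=
  g.map (liftAtom f)

/-- The expanded timed automaton `A(p, λ)`, where the priorities used range over
`{0, …, d-1}`. -/
def expTA (A : TA L C Act) (d : ℕ) (p : L → ℕ) (lam : ℕ) :
    TA (ExpLoc L) (ExpClock C) (ExpAct Act) where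
  init := (A.init, some (p A.init))
  gamma := some A.gamma
  inv := fun lq =>
    match lq.2 with
    | some q => liftCC some (A.inv lq.1) ++
        (if q % 2 = 1 then [⟨none, Cmp.le, lam⟩] else [])
    | none => [⟨none, Cmp.le, 0⟩, ⟨none, Cmp.ge, 0⟩]
  edges :=
    {e : Edge (ExpLoc L) (ExpClock C) (ExpAct Act) |
      ∃ q < d, q % 2 = 0 ∧ ∃ e₀ ∈ A.edges,
        e = ⟨(e₀.src, some q), liftCC some e₀.guard, Sum.inl e₀.act,
             (Option.some '' e₀.resets) ∪ {none}, (e₀.tgt, some (p e₀.tgt))⟩} ∪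
    {e : Edge (ExpLoc L) (ExpClock C) (ExpAct Act) |
      ∃ q < d, q % 2 = 1 ∧ ∃ e₀ ∈ A.edges,
        e = ⟨(e₀.src, some q), liftCC some e₀.guard ++ [⟨none, Cmp.lt, lam⟩],
             Sum.inl e₀.act, Option.some '' e₀.resets,
             (e₀.tgt, some (min q (p e₀.tgt)))⟩} ∪
    {e : Edge (ExpLoc L) (ExpClock C) (ExpAct Act) |
      ∃ q < d, q % 2 = 1 ∧ ∃ (ℓ : L) (b : Bool),
        e = ⟨(ℓ, some q), [⟨none, Cmp.le, lam⟩, ⟨none, Cmp.ge, lam⟩], Sum.inr b,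
             {none}, (ℓ, none)⟩} ∪
    {e : Edge (ExpLoc L) (ExpClock C) (ExpAct Act) |
      ∃ (ℓ : L) (b : Bool), e = ⟨(ℓ, none), [], Sum.inr b, ∅, (ℓ, some (p ℓ))⟩}

/-- The expanded timed game `G(p, λ)`: `β₁` belongs to player 1, `β₂` to player 2. -/
def expTG (G : TG L C Act) (d : ℕ) (p : L → ℕ) (lam : ℕ) :
    TG (ExpLoc L) (ExpClock C) (ExpAct Act) :=
  ⟨expTA G.ta d p lam,
   fun a => match a with | Sum.inl a => G.isP1 a | Sum.inr b => b = true⟩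

/-- The set `Bad = L × {bad}` of bad locations. -/
def BadLocs (L : Type) : Set (ExpLoc L) := {lq | lq.2 = none}

/-! ### The projection mapping -/

def projMove (m : Mv (ExpAct Act)) : Mv Act :=
  (m.1, match m.2 with
        | some (Sum.inl a) => some a
        | some (Sum.inr _) => none
        | none => none)

def projState (s : ExpLoc L × Val (ExpClock C)) : L × Val C :=
  (s.1.1, fun c => s.2 (some c))

/-- The projection mapping `Pr`. -/
def projPlay (π : RawPlay (ExpLoc L) (ExpClock C) (ExpAct Act)) : RawPlay L C Act :=
  ⟨fun n => projState (π.s n), fun n => projMove (π.m1 n), fun n => projMove (π.m2 n)⟩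

/-- A play of the expanded game is well-initialized if `q₀ = p(ℓ₀)` and `ν₀(z) = 0`. -/
def WellInit (p : L → ℕ) (π : RawPlay (ExpLoc L) (ExpClock C) (ExpAct Act)) : Prop :=
  (π.s 0).1.2 = some (p (π.s 0).1.1) ∧ (π.s 0).2 none = 0

/-! ### The expansion mapping -/

def liftMove (m : Mv Act) : Mv (ExpAct Act) := (m.1, m.2.map Sum.inl)

def betaMv {Act : Type} (b : Bool) (t : ℝ≥0) : Mv (ExpAct Act) := (t, some (Sum.inr b))

/-- The conditions relating step `n` of a play `π` of `G` to the segment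
`[f n, f (n+1)]` of its expansion `π'`, following the inductive definition of
the expansion mapping `Ex`. -/
def ExStep (p : L → ℕ) (lam : ℕ) (π : RawPlay L C Act)
    (π' : RawPlay (ExpLoc L) (ExpClock C) (ExpAct Act)) (f : ℕ → ℕ) (n : ℕ) : Prop :=
  ∃ q : ℕ, (π'.s (f n)).1.2 = some q ∧
    (∀ z dn : ℝ≥0, z = (π'.s (f n)).2 none → dn = π.delay n →
      -- Cases 1 and 2.a : no bad window is detected during this step
      ((q % 2 = 0 ∨ z + dn < (lam : ℝ≥0)) →
        f (n + 1) = f n + 1 ∧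
        (q % 2 = 0 →
          π'.m1 (f n) = liftMove (π.m1 n) ∧ π'.m2 (f n) = liftMove (π.m2 n)) ∧
        (q % 2 = 1 →
          ((z + (π.m1 n).1 < (lam : ℝ≥0) → π'.m1 (f n) = liftMove (π.m1 n)) ∧
           ((lam : ℝ≥0) ≤ z + (π.m1 n).1 →
              π'.m1 (f n) = betaMv true ((lam : ℝ≥0) - z)) ∧
           (z + (π.m2 n).1 < (lam : ℝ≥0) → π'.m2 (f n) = liftMove (π.m2 n)) ∧
           ((lam : ℝ≥0) ≤ z + (π.m2 n).1 →
              π'.m2 (f n) = betaMv false ((lam : ℝ≥0) - z))))) ∧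
      -- Case 2.b : a bad window is detected during this step; the expansion
      -- visits the bad location `μ` times
      (q % 2 = 1 → (lam : ℝ≥0) ≤ z + dn →
        ∃ μ : ℕ, 1 ≤ μ ∧
          (p (π.s n).1 % 2 = 0 → μ = 1) ∧
          (p (π.s n).1 % 2 = 1 →
            ((μ * lam : ℕ) : ℝ≥0) ≤ z + dn ∧ z + dn < (((μ + 1) * lam : ℕ) : ℝ≥0)) ∧
          f (n + 1) = f n + 2 * μ + 1 ∧
          (∀ k < μ, (π'.s (f n + 2 * k + 1)).1 = ((π.s n).1, none)) ∧
          (∀ k, 1 ≤ k → k ≤ μ →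
            (π'.s (f n + 2 * k)).1 = ((π.s n).1, some (p (π.s n).1))) ∧
          π'.m1 (f n) = betaMv true ((lam : ℝ≥0) - z) ∧
          π'.m2 (f n) = betaMv false ((lam : ℝ≥0) - z) ∧
          (∀ k < μ, π'.m1 (f n + 2 * k + 1) = betaMv true 0 ∧
                    π'.m2 (f n + 2 * k + 1) = betaMv false 0) ∧
          (∀ k, 1 ≤ k → k < μ →
            π'.m1 (f n + 2 * k) = betaMv true (lam : ℝ≥0) ∧
            π'.m2 (f n + 2 * k) = betaMv false (lam : ℝ≥0)) ∧
          (∀ t' : ℝ≥0, t' = ((lam : ℝ≥0) - z) + ((μ - 1 : ℕ) : ℝ≥0) * (lam : ℝ≥0) →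
            (((π.m1 n).1 - t' < (lam : ℝ≥0) ∨ p (π.s n).1 % 2 = 0) →
              π'.m1 (f n + 2 * μ) = ((π.m1 n).1 - t', (π.m1 n).2.map Sum.inl)) ∧
            (¬ ((π.m1 n).1 - t' < (lam : ℝ≥0) ∨ p (π.s n).1 % 2 = 0) →
              π'.m1 (f n + 2 * μ) = betaMv true (lam : ℝ≥0)) ∧
            (((π.m2 n).1 - t' < (lam : ℝ≥0) ∨ p (π.s n).1 % 2 = 0) →
              π'.m2 (f n + 2 * μ) = ((π.m2 n).1 - t', (π.m2 n).2.map Sum.inl)) ∧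
            (¬ ((π.m2 n).1 - t' < (lam : ℝ≥0) ∨ p (π.s n).1 % 2 = 0) →
              π'.m2 (f n + 2 * μ) = betaMv false (lam : ℝ≥0)))))

/-- `π'` is the expansion `Ex(π)` of the play `π`, presented relationally:
`π'` is a play of the expanded game `G(p, λ)`, and there is an alignment
function `f` matching each step of `π` with the corresponding segment of `π'`
according to the inductive definition of the expansion mapping. -/
def IsExpansion (G : TG L C Act) (d : ℕ) (p : L → ℕ) (lam : ℕ)
    (π : RawPlay L C Act) (π' : RawPlay (ExpLoc L) (ExpClock C) (ExpAct Act)) : Prop :=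
  (expTG G d p lam).IsPlay π' ∧
  ∃ f : ℕ → ℕ, f 0 = 0 ∧ StrictMono f ∧
    (π'.s 0).1.2 = some (p (π.s 0).1) ∧ (π'.s 0).2 none = 0 ∧
    (∀ n, (π'.s (f n)).1.1 = (π.s n).1 ∧ (π'.s (f n)).1.2 ≠ none ∧
          (∀ c : C, (π'.s (f n)).2 (some c) = (π.s n).2 c)) ∧
    (∀ n, ExStep p lam π π' f n)

/-- The finite-play version of `IsExpansion`: the first `N` steps of `π'` form
the expansion of the finite play consisting of the first `n` steps of `π`. -/
def IsExpansionUpTo (G : TG L C Act) (d : ℕ) (p : L → ℕ) (lam : ℕ)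
    (π : RawPlay L C Act) (π' : RawPlay (ExpLoc L) (ExpClock C) (ExpAct Act))
    (n N : ℕ) : Prop :=
  (expTG G d p lam).IsPlayUpTo π' N ∧
  ∃ f : ℕ → ℕ, f 0 = 0 ∧ StrictMono f ∧ f n = N ∧
    (π'.s 0).1.2 = some (p (π.s 0).1) ∧ (π'.s 0).2 none = 0 ∧
    (∀ k ≤ n, (π'.s (f k)).1.1 = (π.s k).1 ∧ (π'.s (f k)).1.2 ≠ none ∧
          (∀ c : C, (π'.s (f k)).2 (some c) = (π.s k).2 c)) ∧
    (∀ k < n, ExStep p lam π π' f k)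

/-! ### Strategies -/

/-- A strategy: given the length `n` of the history and a play (of which only
the first `n` steps are meaningful), produce a move. -/
abbrev Strategy (L C Act : Type) := ℕ → RawPlay L C Act → Mv Act

/-- A strategy depends only on the (relevant prefix of the) history. -/
def PrefixDep (σ : Strategy L C Act) : Prop :=
  ∀ n (π π' : RawPlay L C Act), (∀ k ≤ n, π.s k = π'.s k) →
    (∀ k < n, π.m1 k = π'.m1 k ∧ π.m2 k = π'.m2 k) → σ n π = σ n π'

/-- A move-independent strategy: it depends only on the sequence of states. -/
def MoveIndep (σ : Strategy L C Act) : Prop :=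
  ∀ n (π π' : RawPlay L C Act), (∀ k ≤ n, π.s k = π'.s k) → σ n π = σ n π'

/-- `σ` is a valid player-1 strategy in `G`. -/
def IsStrategy1 (G : TG L C Act) (σ : Strategy L C Act) : Prop :=
  PrefixDep σ ∧ ∀ n π, G.IsPlayUpTo π n → G.Move1 (π.s n) (σ n π)

/-- The play `π` is consistent with the player-1 strategy `σ`. -/
def Consistent1 (σ : Strategy L C Act) (π : RawPlay L C Act) : Prop :=
  ∀ n, π.m1 n = σ n π

/-- Player 1 is not responsible for the transition at step `n` of `π`. -/
def NotResp1 (G : TG L C Act) (π : RawPlay L C Act) (n : ℕ) : Prop :=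
  (π.m2 n).1 < (π.m1 n).1 ∨
  ((π.m1 n).1 = (π.m2 n).1 ∧ ¬ G.ta.Trans (π.s n) (π.m1 n) (π.s (n + 1)))

/-- A play is `P₁`-blameless if from some step on, player 1 is never
responsible for the transition. -/
def Blameless1 (G : TG L C Act) (π : RawPlay L C Act) : Prop :=
  ∃ N, ∀ n ≥ N, NotResp1 G π n

/-- `σ` is a winning player-1 strategy from `s0` for the objective `Ψ`:
every consistent play from `s0` is either time-divergent and in `Ψ`, or
time-convergent and `P₁`-blameless. -/
def Winning1 (G : TG L C Act) (σ : Strategy L C Act) (Ψ : Set (Trace L C))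
    (s0 : L × Val C) : Prop :=
  IsStrategy1 G σ ∧ ∀ π : RawPlay L C Act, G.IsPlay π → π.s 0 = s0 → Consistent1 σ π →
    (TimeDiv G.ta.gamma π.trace ∧ π.trace ∈ Ψ) ∨
    (¬ TimeDiv G.ta.gamma π.trace ∧ Blameless1 G π)

/-! ### The multi-dimensional expanded automaton -/

/-- Locations of the multi-dimensional expanded automaton. -/
abbrev MExpLoc (L : Type) (k : ℕ) := L × Option (Fin k → ℕ)
/-- Clocks of the multi-dimensional expanded automaton: `Sum.inr i` is `z_i`. -/
abbrev MExpClock (C : Type) (k : ℕ) := C ⊕ Fin k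

/-- The update function for vectors of priorities. -/
def mUp {k : ℕ} (q : Fin k → ℕ) (p : L → Fin k → ℕ) (ℓ : L) : Fin k → ℕ :=
  fun i => if q i % 2 = 1 then min (q i) (p ℓ i) else p ℓ i

/-- The multi-dimensional expanded timed automaton `A(p, λ)` for a
`k`-dimensional priority function with priorities in `{0, …, d-1}`. -/
def mExpTA (A : TA L C Act) (k d : ℕ) (hk : 0 < k) (p : L → Fin k → ℕ)
    (lam : Fin k → ℕ) : TA (MExpLoc L k) (MExpClock C k) (ExpAct Act) where
  init := (A.init, some (p A.init))
  gamma := Sum.inl A.gamma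
  inv := fun lq =>
    match lq.2 with
    | some q => liftCC Sum.inl (A.inv lq.1) ++
        ((List.finRange k).filter (fun i => decide (q i % 2 = 1))).map
          (fun i => ⟨Sum.inr i, Cmp.le, lam i⟩)
    | none => [⟨Sum.inr ⟨0, hk⟩, Cmp.le, 0⟩, ⟨Sum.inr ⟨0, hk⟩, Cmp.ge, 0⟩]
  edges :=
    {e : Edge (MExpLoc L k) (MExpClock C k) (ExpAct Act) |
      ∃ q : Fin k → ℕ, (∀ i, q i < d) ∧ ∃ e₀ ∈ A.edges,
        e = ⟨(e₀.src, some q),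
             liftCC Sum.inl e₀.guard ++
               ((List.finRange k).filter (fun i => decide (q i % 2 = 1))).map
                 (fun i => ⟨Sum.inr i, Cmp.lt, lam i⟩),
             Sum.inl e₀.act,
             (Sum.inl '' e₀.resets) ∪ (Sum.inr '' {i : Fin k | ¬ q i % 2 = 1}),
             (e₀.tgt, some (mUp q p e₀.tgt))⟩} ∪
    {e : Edge (MExpLoc L k) (MExpClock C k) (ExpAct Act) |
      ∃ q : Fin k → ℕ, (∀ i, q i < d) ∧ ∃ (ℓ : L) (i : Fin k) (b : Bool), q i % 2 = 1 ∧
        e = ⟨(ℓ, some q),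
             [⟨Sum.inr i, Cmp.le, lam i⟩, ⟨Sum.inr i, Cmp.ge, lam i⟩] ++
               ((List.finRange k).filter (fun j => decide (j < i ∧ q j % 2 = 1))).map
                 (fun j => ⟨Sum.inr j, Cmp.lt, lam j⟩),
             Sum.inr b, Sum.inr '' (Set.univ : Set (Fin k)), (ℓ, none)⟩} ∪
    {e : Edge (MExpLoc L k) (MExpClock C k) (ExpAct Act) |
      ∃ (ℓ : L) (b : Bool), e = ⟨(ℓ, none), [], Sum.inr b, ∅, (ℓ, some (p ℓ))⟩}

/-- The multi-dimensional expanded timed game `G(p, λ)`. -/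
def mExpTG (G : TG L C Act) (k d : ℕ) (hk : 0 < k) (p : L → Fin k → ℕ)
    (lam : Fin k → ℕ) : TG (MExpLoc L k) (MExpClock C k) (ExpAct Act) :=
  ⟨mExpTA G.ta k d hk p lam,
   fun a => match a with | Sum.inl a => G.isP1 a | Sum.inr b => b = true⟩

/-- The set of bad locations of the multi-dimensional expanded automaton. -/
def MBadLocs (L : Type) (k : ℕ) : Set (MExpLoc L k) := {lq | lq.2 = none}

/-- The generalized timed window objective `GTW(p, λ)`. -/
def GTW (γ : C) {k : ℕ} (p : L → Fin k → ℕ) (lam : Fin k → ℕ) : Set (Trace L C) :=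
  {τ | ∀ i : Fin k, τ ∈ TW γ (fun ℓ => p ℓ i) (lam i)}

/-- The generalized direct timed window objective `GDTW(p, λ)`. -/
def GDTW (γ : C) {k : ℕ} (p : L → Fin k → ℕ) (lam : Fin k → ℕ) : Set (Trace L C) :=
  {τ | ∀ i : Fin k, τ ∈ DTW γ (fun ℓ => p ℓ i) (lam i)}

end TWPaper
namespace TWPaper

/-- The effect of one step of the expanded game on the window component: `r`, `r'` are the
priorities of the underlying locations, `q`, `q'` the window components, `z`, `z'` the values of
the fresh clock, before and after a step of delay `δ`. -/
inductive WindowStep (lam r r' : ℕ) (q q' : Option ℕ) (z z' δ : ℝ≥0) : Prop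
  | stay (w : ℕ) (hq : q = some w) (hq' : q' = some w) (hr : r' = r) (hz : z' = z + δ)
      (hle : w % 2 = 1 → z' ≤ lam)
  | stayBad (hq : q = none) (hq' : q' = none) (hδ : δ = 0)
  | reopen (w : ℕ) (hq : q = some w) (hw : w % 2 = 0) (hq' : q' = some r') (hz : z' = 0)
  | extend (w : ℕ) (hq : q = some w) (hw : w % 2 = 1) (hq' : q' = some (min w r'))
      (hz : z' = z + δ) (hlt : z' < lam)
  | expire (w : ℕ) (hq : q = some w) (hw : w % 2 = 1) (hq' : q' = none) (hz : z + δ = lam)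
  | restart (hq : q = none) (hq' : q' = some r') (hz : z' = 0)

section Transitions

variable {L C Act : Type}

lemma satCC_append {ν : Val C} {g h : ClockConstraint C} :
    satCC ν (g ++ h) ↔ satCC ν g ∧ satCC ν h := by
  simp [satCC, or_imp, forall_and]

lemma windowStep_of_trans {A : TA L C Act} {d : ℕ} {p : L → ℕ} {lam : ℕ}
    {s s' : ExpLoc L × Val (ExpClock C)} {m : Mv (ExpAct Act)}
    (h : (expTA A d p lam).Trans s m s') :
    WindowStep lam (p s.1.1) (p s'.1.1) s.1.2 s'.1.2 (s.2 none) (s'.2 none) m.1 := by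
  obtain ⟨⟨ℓ, q⟩, ν⟩ := s
  obtain ⟨⟨ℓ', q'⟩, ν'⟩ := s'
  obtain ⟨δ, a⟩ := m
  obtain ⟨hinv, hact⟩ := h
  have hbad : q = none → ν none + δ = 0 := by
    rintro rfl
    have := hinv ⟨none, Cmp.le, 0⟩ (by simp [expTA])
    simpa [Atom.sat, shift] using this
  have hodd : ∀ w, q = some w → w % 2 = 1 → ν none + δ ≤ lam := by
    rintro w rfl hw
    have := hinv ⟨none, Cmp.le, lam⟩ (by simp [expTA, hw])
    simpa [Atom.sat, shift] using this
  cases a with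
  | none =>
    obtain ⟨hl, hν⟩ := hact
    simp only [Prod.mk.injEq] at hl hν
    obtain ⟨rfl, rfl⟩ := hl
    have hz : ν' none = ν none + δ := by rw [hν]; rfl
    cases q' with
    | none => exact .stayBad rfl rfl (add_eq_zero.mp (hbad rfl)).2
    | some w => exact .stay w rfl rfl rfl hz fun hw => hz.trans_le (hodd w rfl hw)
  | some a =>
    obtain ⟨e, he, hsrc, -, hg, htgt, hν, -⟩ := hact
    simp only at hsrc htgt hν
    rcases he with ((⟨w, -, hw, e₀, -, rfl⟩ | ⟨w, -, hw, e₀, -, rfl⟩) |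
      ⟨w, -, hw, ℓ₀, b, rfl⟩) | ⟨ℓ₀, b, rfl⟩
    all_goals
      simp only [Prod.mk.injEq] at hsrc htgt
      obtain ⟨rfl, rfl⟩ := hsrc
      obtain ⟨rfl, rfl⟩ := htgt
    · exact .reopen w rfl hw rfl (by simp [hν, resetV])
    · have hz : ν' none = ν none + δ := by simp [hν, resetV, shift]
      refine .extend w rfl hw rfl hz ?_
      have := (satCC_append.mp hg).2 ⟨none, Cmp.lt, lam⟩ (by simp)
      simpa [Atom.sat, shift, hz] using this
    · refine .expire w rfl hw rfl (le_antisymm (hodd w rfl hw) ?_)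
      have := hg ⟨none, Cmp.ge, lam⟩ (by simp)
      simpa [Atom.sat, shift] using this
    · refine .restart rfl rfl ?_
      simpa [hν, resetV, shift] using hbad rfl

lemma gamma_of_trans {A : TA L C Act} (hA : ∀ e ∈ A.edges, A.gamma ∉ e.resets)
    {d : ℕ} {p : L → ℕ} {lam : ℕ}
    {s s' : ExpLoc L × Val (ExpClock C)} {m : Mv (ExpAct Act)}
    (h : (expTA A d p lam).Trans s m s') :
    s'.2 (some A.gamma) = s.2 (some A.gamma) + m.1 := by
  obtain ⟨δ, a⟩ := m
  obtain ⟨-, hact⟩ := h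
  cases a with
  | none => rw [hact.2]; rfl
  | some a =>
    obtain ⟨e, he, -, -, -, -, hν, -⟩ := hact
    rw [hν]
    rcases he with ((⟨w, -, hw, e₀, he₀, rfl⟩ | ⟨w, -, hw, e₀, he₀, rfl⟩) |
      ⟨w, -, hw, ℓ₀, b, rfl⟩) | ⟨ℓ₀, b, rfl⟩
    · simp [resetV, shift, hA e₀ he₀]
    · simp [resetV, shift, hA e₀ he₀]
    · simp [resetV, shift]
    · simp [resetV, shift]

lemma TG.StepOK.exists_trans {G : TG L C Act} {π : RawPlay L C Act} {n : ℕ}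
    (h : G.StepOK π n) :
    ∃ m : Mv Act, m.1 = π.delay n ∧ G.ta.Trans (π.s n) m (π.s (n + 1)) := by
  rcases h.2.2 with ⟨hlt, ht⟩ | ⟨hlt, ht⟩ | ⟨heq, ht | ht⟩
  · exact ⟨_, (min_eq_left hlt.le).symm, ht⟩
  · exact ⟨_, (min_eq_right hlt.le).symm, ht⟩
  · exact ⟨_, (min_eq_left heq.le).symm, ht⟩
  · exact ⟨_, (min_eq_right heq.ge).symm, ht⟩

end Transitions

section Windows

variable {L C : Type}

lemma minPrioIcc_delayedSuffix (p : L → ℕ) (τ : Trace L C) (n : ℕ) (t : ℝ≥0) (a b : ℕ) :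
    minPrioIcc p (τ.delayedSuffix n t) a b = minPrioIcc p τ (n + a) (n + b) := by
  have hloc : ∀ k, ((τ.delayedSuffix n t).st k).1 = (τ.st (n + k)).1 := by
    intro k
    by_cases hk : k = 0 <;> simp [Trace.delayedSuffix, hk]
  unfold minPrioIcc
  rw [← Set.image_const_add_Icc, Set.image_image]
  simp only [hloc]

lemma suffix_st (τ : Trace L C) (n k : ℕ) : (τ.suffix n).st k = τ.st (n + k) := by
  by_cases hk : k = 0
  · subst hk
    refine Prod.ext rfl (funext fun c => ?_)
    simp [Trace.suffix, Trace.delayedSuffix, shift]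
  · simp [Trace.suffix, Trace.delayedSuffix, hk]

lemma minPrioIcc_eq_of_isLeast {p : L → ℕ} {τ : Trace L C} {a b v : ℕ}
    (h : IsLeast ((fun k => p (τ.st k).1) '' Set.Icc a b) v) : minPrioIcc p τ a b = v :=
  h.csInf_eq

lemma exists_window_of_suffix_mem_DTW {γ : C} {p : L → ℕ} {lam : ℕ} {τ : Trace L C} {n : ℕ}
    (h : τ.suffix n ∈ DTW γ p lam) {k : ℕ} (hk : n ≤ k) :
    ∃ j ≥ k, Even (minPrioIcc p τ k j) ∧ (τ.st j).2 γ - (τ.st k).2 γ < (lam : ℝ≥0) := by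
  obtain ⟨m, rfl⟩ := Nat.exists_eq_add_of_le hk
  obtain ⟨j, hj, hlt⟩ := h m 0 zero_le
  have hst : ∀ i, (((τ.suffix n).delayedSuffix m 0).st i) = τ.st (n + m + i) := by
    intro i
    change (((τ.suffix n).suffix m).st i) = _
    rw [suffix_st, suffix_st, add_assoc]
  rw [hst, hst] at hlt
  rw [minPrioIcc_delayedSuffix, Trace.suffix, minPrioIcc_delayedSuffix] at hj
  exact ⟨n + m + j, by omega, by simpa [add_assoc] using hj, hlt⟩

lemma suffix_mem_DTW {γ : C} {p : L → ℕ} {lam : ℕ} (hlam : lam ≠ 0) {τ : Trace L C} {n : ℕ}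
    (h : ∀ k ≥ n, Even (p (τ.st k).1) ∨
      ∃ j > k, Even (minPrioIcc p τ k j) ∧ (τ.st j).2 γ - (τ.st k).2 γ < (lam : ℝ≥0)) :
    τ.suffix n ∈ DTW γ p lam := by
  intro m t _
  rcases h (n + m) (by omega) with he | ⟨j, hj, he, hlt⟩
  · refine ⟨0, ?_, ?_⟩
    · rw [minPrioIcc_delayedSuffix, Trace.suffix, minPrioIcc_delayedSuffix]
      simpa [minPrioIcc] using he
    · simpa using Nat.pos_of_ne_zero hlam
  · obtain ⟨i, rfl⟩ := Nat.exists_eq_add_of_lt hj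
    refine ⟨i + 1, ?_, ?_⟩
    · rw [minPrioIcc_delayedSuffix, Trace.suffix, minPrioIcc_delayedSuffix]
      simpa [add_assoc] using he
    · refine lt_of_le_of_lt ?_ hlt
      have h1 : ((τ.suffix n).delayedSuffix m t).st (i + 1) = τ.st (n + m + i + 1) := by
        rw [show n + m + i + 1 = n + (m + (i + 1)) by ring, ← suffix_st τ n]
        simp [Trace.delayedSuffix]
      have h0 : (((τ.suffix n).delayedSuffix m t).st 0).2 γ = (τ.st (n + m)).2 γ + t := by
        rw [← suffix_st]
        simp [Trace.delayedSuffix, shift]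
      rw [h1, h0]
      exact tsub_le_tsub_left le_self_add _

end Windows

section Sequences

variable {lam : ℕ} {r : ℕ → ℕ} {q : ℕ → Option ℕ} {z g δ : ℕ → ℝ≥0}

lemma window_le_priority
    (hstep : ∀ n, WindowStep lam (r n) (r (n + 1)) (q n) (q (n + 1)) (z n) (z (n + 1)) (δ n))
    (h0 : q 0 = some (r 0)) (n w : ℕ) (hw : q n = some w) :
    w ≤ r n ∧ (w % 2 = 0 → w = r n) := by
  induction n generalizing w with
  | zero => simp_all
  | succ n ih =>
    rcases hstep n with ⟨v, hq, hq', hr, -, -⟩ | ⟨-, hq', -⟩ | ⟨v, -, -, hq', -⟩ |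
      ⟨v, hq, hv, hq', -, -⟩ | ⟨v, -, -, hq', -⟩ | ⟨-, hq', -⟩
    · have := ih v hq
      grind
    all_goals grind

lemma gamma_mono (hg : ∀ n, g (n + 1) = g n + δ n) : Monotone g :=
  monotone_nat_of_le_succ fun n => hg n ▸ le_self_add

/-- While an odd window is open and no bad location is visited, divergence of time forces the
window to close on an even priority strictly before the bound. -/
lemma exists_window_closing
    (hstep : ∀ n, WindowStep lam (r n) (r (n + 1)) (q n) (q (n + 1)) (z n) (z (n + 1)) (δ n))
    (hg : ∀ n, g (n + 1) = g n + δ n) (hdiv : ∀ B : ℝ≥0, ∃ j, B < g j)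
    (h0 : q 0 = some (r 0)) {m v : ℕ} (hv : q m = some v) (hodd : v % 2 = 1)
    (hbad : ∀ n ≥ m, q n ≠ none) :
    ∃ j > m, Even (r j) ∧ (∀ t ∈ Set.Icc m j, r j ≤ r t) ∧ g j - g m < lam := by
  by_contra hno
  have key : ∀ i, m ≤ i → ∃ w, q i = some w ∧ w % 2 = 1 ∧ (∀ t ∈ Set.Icc m i, w ≤ r t) ∧
      g i ≤ z i + g m ∧ (m < i → z i ≤ lam) := by
    intro i hi
    induction i, hi using Nat.le_induction with
    | base =>
      exact ⟨v, hv, hodd, fun t ht => le_antisymm ht.1 ht.2 ▸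
        (window_le_priority hstep h0 m v hv).1, le_add_self, fun h => absurd h (lt_irrefl m)⟩
    | succ i hi ih =>
      obtain ⟨w, hw, hwo, hmin, hgz, -⟩ := ih
      have hgz' : g (i + 1) ≤ z i + δ i + g m := by
        rw [hg, add_right_comm]
        gcongr
      rcases hstep i with ⟨u, hq, hq', hr, hz, hle⟩ | ⟨hq, -, -⟩ | ⟨u, hq, hu, -, -⟩ |
        ⟨u, hq, hu, hq', hz, hlt⟩ | ⟨u, -, -, hq', -⟩ | ⟨hq, -, -⟩
      · obtain rfl : w = u := by simpa [hw] using hq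
        refine ⟨w, hq', hwo, ?_, hz ▸ hgz', fun _ => hle hwo⟩
        rintro t ⟨ht1, ht2⟩
        rcases Nat.le_succ_iff.mp ht2 with ht | rfl
        · exact hmin t ⟨ht1, ht⟩
        · exact hr ▸ hmin i ⟨hi, le_rfl⟩
      · simp [hw] at hq
      · grind
      · obtain rfl : w = u := by simpa [hw] using hq
        have hmin' : ∀ t ∈ Set.Icc m (i + 1), min w (r (i + 1)) ≤ r t := by
          rintro t ⟨ht1, ht2⟩
          rcases Nat.le_succ_iff.mp ht2 with ht | rfl
          · exact (min_le_left _ _).trans (hmin t ⟨ht1, ht⟩)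
          · exact min_le_right _ _
        refine ⟨_, hq', ?_, hmin', hz ▸ hgz', fun _ => hlt.le⟩
        by_contra hev
        have hmr : min w (r (i + 1)) = r (i + 1) := by
          rcases min_choice w (r (i + 1)) with h | h
          · rw [h] at hev; contradiction
          · exact h
        rw [hmr] at hev hmin'
        refine hno ⟨i + 1, by omega, Nat.even_iff.mpr (by omega), hmin', ?_⟩
        exact lt_of_le_of_lt (tsub_le_iff_right.mpr (hz ▸ hgz')) hlt
      · exact absurd hq' (hbad _ (by omega))
      · simp [hw] at hq
  obtain ⟨j, hj⟩ := hdiv (lam + g m)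
  have hjm : m < j := by
    by_contra hle
    exact absurd (hj.trans_le (gamma_mono hg (not_lt.mp hle))) (not_lt.mpr le_add_self)
  obtain ⟨w, -, -, -, hgz, hz⟩ := key j hjm.le
  exact absurd hj (not_lt.mpr (hgz.trans (by gcongr; exact hz hjm)))

/-- If from index `N` on every position starts a good window, then only finitely many bad
locations are visited. -/
lemma eventually_ne_bad
    (hstep : ∀ n, WindowStep lam (r n) (r (n + 1)) (q n) (q (n + 1)) (z n) (z (n + 1)) (δ n))
    (hg : ∀ n, g (n + 1) = g n + δ n) (hdiv : ∀ B : ℝ≥0, ∃ j, B < g j) {n : ℕ}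
    (hgood : ∀ k ≥ n, ∃ j ≥ k, Even (sInf (r '' Set.Icc k j)) ∧ g j - g k < lam) :
    ∃ N, ∀ i ≥ N, q i ≠ none := by
  by_cases hN : ∀ i ≥ n, q i ≠ none
  · exact ⟨n, hN⟩
  push Not at hN
  obtain ⟨N, hnN, hN⟩ := hN
  have inv : ∀ i, N ≤ i → ∀ w, q i = some w → w % 2 = 1 → ∃ k ≥ n, k ≤ i ∧
      IsLeast (r '' Set.Icc k i) w ∧ (∀ t ∈ Set.Icc k i, ¬ Even (sInf (r '' Set.Icc k t))) ∧
      z i + g k = g i := by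
    have hopen : ∀ i, n ≤ i → z i = 0 → r i % 2 = 1 → ∃ k ≥ n, k ≤ i ∧
        IsLeast (r '' Set.Icc k i) (r i) ∧
        (∀ t ∈ Set.Icc k i, ¬ Even (sInf (r '' Set.Icc k t))) ∧ z i + g k = g i := by
      intro i hi hz hr
      refine ⟨i, hi, le_rfl, by simp, ?_, by simp [hz]⟩
      intro t ht
      obtain rfl := le_antisymm ht.1 ht.2
      simpa [Nat.even_iff] using hr
    have hclose : ∀ i w u, u % 2 = 1 → n ≤ i → (∃ k ≥ n, k ≤ i ∧
        IsLeast (r '' Set.Icc k i) w ∧ (∀ t ∈ Set.Icc k i, ¬ Even (sInf (r '' Set.Icc k t))) ∧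
        z i + g k = g i) → u = min w (r (i + 1)) → z (i + 1) = z i + δ i → ∃ k ≥ n, k ≤ i + 1 ∧
        IsLeast (r '' Set.Icc k (i + 1)) u ∧
        (∀ t ∈ Set.Icc k (i + 1), ¬ Even (sInf (r '' Set.Icc k t))) ∧
        z (i + 1) + g k = g (i + 1) := by
      rintro i w u hu hi ⟨k, hk, hki, hl, ho, hzg⟩ rfl hz
      have hl' : IsLeast (r '' Set.Icc k (i + 1)) (min w (r (i + 1))) := by
        rw [← Order.succ_eq_add_one i,
          ← Set.insert_Icc_right_eq_Icc_succ (hki.trans (Order.le_succ i)),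
          Set.image_insert_eq, min_comm]
        exact hl.insert _
      refine ⟨k, hk, by omega, hl', ?_, by rw [hz, hg, ← hzg]; ring⟩
      rintro t ⟨ht1, ht2⟩
      rcases Nat.le_succ_iff.mp ht2 with ht | rfl
      · exact ho t ⟨ht1, ht⟩
      · rw [hl'.csInf_eq, Nat.even_iff]
        omega
    intro i hi
    induction i, hi using Nat.le_induction with
    | base => simp [hN]
    | succ i hi ih =>
      intro w hw hwo
      rcases hstep i with ⟨u, hq, hq', hr, hz, -⟩ | ⟨-, hq', -⟩ | ⟨u, -, -, hq', hz⟩ |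
        ⟨u, hq, hu, hq', hz, -⟩ | ⟨u, -, -, hq', -⟩ | ⟨-, hq', hz⟩
      · obtain rfl : u = w := by simpa [hw] using hq'.symm
        obtain ⟨k, hk⟩ := ih u hq hwo
        have : u ≤ r (i + 1) := hr ▸ hk.2.2.1.2 ⟨i, ⟨hk.2.1, le_rfl⟩, rfl⟩
        exact hclose i u u hwo (by omega) ⟨k, hk⟩ (min_eq_left this).symm hz
      · simp [hw] at hq'
      · obtain rfl : w = r (i + 1) := by simpa [hw] using hq'
        exact hopen _ (by omega) hz hwo
      · exact hclose i u w hwo (by omega) (ih u hq hu) (by simpa [hw] using hq') hz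
      · simp [hw] at hq'
      · obtain rfl : w = r (i + 1) := by simpa [hw] using hq'
        exact hopen _ (by omega) hz hwo
  have hpres : ∀ i, N ≤ i → q i ≠ none → q (i + 1) ≠ none := by
    intro i hi hqi hbad
    rcases hstep i with ⟨u, hq, hq', -, -, -⟩ | ⟨hq, -, -⟩ | ⟨u, -, -, hq', hz⟩ |
        ⟨u, hq, hu, hq', hz, -⟩ | ⟨u, hq, hu, hq', hz⟩ | ⟨-, hq', hz⟩
    · simp [hbad] at hq'
    · exact hqi hq
    · simp [hbad] at hq'
    · simp [hbad] at hq'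
    · obtain ⟨k, hk, hki, -, ho, hzg⟩ := inv i hi u hq hu
      obtain ⟨j, hj, he, hlt⟩ := hgood k hk
      have hji : i < j := by
        by_contra hle
        exact ho j ⟨hj, not_lt.mp hle⟩ he
      have hgi : g (i + 1) = lam + g k := by rw [hg, ← hzg, ← hz]; ring
      have hle : (lam : ℝ≥0) ≤ g j - g k :=
        le_tsub_of_add_le_right (hgi ▸ gamma_mono hg hji)
      exact absurd hlt (not_lt.mpr hle)
    · simp [hbad] at hq'
  by_cases hex : ∃ M ≥ N, q M ≠ none
  · obtain ⟨M, hNM, hM⟩ := hex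
    refine ⟨M, fun i hi => ?_⟩
    induction i, hi using Nat.le_induction with
    | base => exact hM
    | succ i hi ih => exact hpres i (by omega) ih
  push Not at hex
  have hconst : ∀ i, N ≤ i → g i = g N := by
    intro i hi
    induction i, hi using Nat.le_induction with
    | base => rfl
    | succ i hi ih =>
      have h1 := hex i hi
      have h2 := hex (i + 1) (by omega)
      rcases hstep i with ⟨u, hq, -, -, -, -⟩ | ⟨-, -, hδ⟩ | ⟨u, hq, -, -, -⟩ |
        ⟨u, hq, -, -, -, -⟩ | ⟨u, hq, -, -, -⟩ | ⟨-, hq', -⟩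
      all_goals first
        | (rw [hg, ih, hδ, add_zero])
        | simp_all
  obtain ⟨j, hj⟩ := hdiv (g N)
  rcases le_total N j with h | h
  · exact absurd hj (hconst j h).not_gt
  · exact absurd hj (gamma_mono hg h).not_gt

end Sequences

/-- For every well-initialized time-divergent play `π̄` of the
expanded game `G(p,λ)`: `π̄` satisfies `coBüchi(Bad)` iff its projection
`Pr(π̄)` satisfies `TW(p,λ)` in `G`, where `Bad = L × {bad}`. -/
theorem statement8 {L C Act : Type} [Finite L] [Finite C] [Finite Act]
    (G : TG L C Act) (hwf : G.ta.WellFormed)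
    (d : ℕ) (p : L → ℕ) (hp : ∀ ℓ, p ℓ < d)
    (lam : ℕ) (hlam : lam ≠ 0)
    (π' : RawPlay (ExpLoc L) (ExpClock C) (ExpAct Act))
    (hπ' : (expTG G d p lam).IsPlay π')
    (hwi : WellInit p π')
    (hdiv : TimeDiv (some G.ta.gamma) π'.trace) :
    π'.trace ∈ CoBuchiObj (BadLocs L) ↔ (projPlay π').trace ∈ TW G.ta.gamma p lam := by
  have hstep : ∀ n, WindowStep lam (p (π'.s n).1.1) (p (π'.s (n + 1)).1.1) (π'.s n).1.2
      (π'.s (n + 1)).1.2 ((π'.s n).2 none) ((π'.s (n + 1)).2 none) (π'.delay n) := fun n => by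
    obtain ⟨m, hm, ht⟩ := (hπ' n).exists_trans
    exact hm ▸ windowStep_of_trans ht
  have hg : ∀ n, (π'.s (n + 1)).2 (some G.ta.gamma) =
      (π'.s n).2 (some G.ta.gamma) + π'.delay n := fun n => by
    obtain ⟨m, hm, ht⟩ := (hπ' n).exists_trans
    exact hm ▸ gamma_of_trans hwf.1 ht
  constructor
  · rintro ⟨N, hN⟩
    refine ⟨N, suffix_mem_DTW hlam fun k hk => ?_⟩
    obtain ⟨w, hw⟩ := Option.ne_none_iff_exists'.mp (hN k hk)
    rcases Nat.mod_two_eq_zero_or_one w with hev | hodd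
    · left
      have := (window_le_priority (r := fun n => p (π'.s n).1.1)
        (q := fun n => (π'.s n).1.2) hstep hwi.1 k w hw).2 hev
      exact Nat.even_iff.mpr (this ▸ hev)
    · right
      obtain ⟨j, hj, he, hmin, hlt⟩ := exists_window_closing (r := fun n => p (π'.s n).1.1)
        (q := fun n => (π'.s n).1.2) hstep hg hdiv hwi.1 hw hodd
        (fun n hn => hN n (hk.trans hn))
      have hl : IsLeast ((fun i => p (((projPlay π').trace.st i).1)) '' Set.Icc k j)
          (p (π'.s j).1.1) :=
        ⟨⟨j, ⟨hj.le, le_rfl⟩, rfl⟩, by rintro _ ⟨t, ht, rfl⟩; exact hmin t ht⟩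
      exact ⟨j, hj, (minPrioIcc_eq_of_isLeast hl).symm ▸ he, hlt⟩
  · rintro ⟨n, hn⟩
    exact eventually_ne_bad (r := fun n => p (π'.s n).1.1) hstep hg hdiv
      fun k hk => exists_window_of_suffix_mem_DTW hn hk

end TWPaper
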